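/- Average time to climb towards a maximum of Jump_m. There is an absolute constant C > 0 with the following property. Let n ≥ 3, let m be an integer with 1 < m < n/2, and let p, q ∈ (0,1) satisfy (m/(2(n − 2m)))·(q + 4/n) ≥ p. Consider the MMAHH with acceptance operators OI and AM on f = Jump_m, started from any x_0 ∈ {0,1}^n and s_0 = OI, and let T_1 = inf{t ≥ 0 : ‖x_t‖₁ ∈ {n − m, n}} be the first time a local maximum or the global maximum of Jump_m is reached. Then E[T_1] ≤ C·n·(1 + p·n)·(1/p + 1/q). -/

import Mathlib

open MeasureTheory
open scoped ENNReal NNReal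

namespace MMAHHStmt

/-- The two acceptance operators. -/
inductive Op : Type
  | OI : Op
  | AM : Op
  deriving DecidableEq

instance : MeasurableSpace Op := ⊤

/-- Search points: bit-strings of length `n`. -/
abbrev Point (n : ℕ) := Fin n → Bool

/-- The number of one-bits of a bit-string. -/
def ones {n : ℕ} (x : Point n) : ℕ := (Finset.univ.filter fun i => x i = true).card

/-- The all-ones string, the global optimum of all benchmarks considered. -/
def optimum (n : ℕ) : Point n := fun _ => true

/-- Flipping the bit in position `v`. -/
def flipBit {n : ℕ} (x : Point n) (v : Fin n) : Point n := Function.update x v (!(x v))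

open Classical in
/-- The search point obtained from `x` by proposing to flip bit `v` and applying the
acceptance operator `op` for the objective function `f`. -/
noncomputable def movedPoint {n : ℕ} (f : Point n → ℝ) (op : Op) (x : Point n) (v : Fin n) :
    Point n :=
  match op with
  | Op.OI => if f x < f (flipBit x v) then flipBit x v else x
  | Op.AM => flipBit x v

open Classical in
/-- One-step transition probability of the search point under acceptance operator `op`:
a uniformly random bit is flipped and the move is accepted or rejected according to `op`. -/
noncomputable def moveProb {n : ℕ} (f : Point n → ℝ) (op : Op) (x x' : Point n) : ℝ≥0∞ :=
  ((Finset.univ.filter fun v => movedPoint f op x v = x').card : ℝ≥0∞) / n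

/-- Transition probabilities of the two-state Markov chain on the acceptance operators. -/
noncomputable def switchProb (p q : ℝ) : Op → Op → ℝ≥0∞
  | Op.OI, Op.OI => ENNReal.ofReal (1 - p)
  | Op.OI, Op.AM => ENNReal.ofReal p
  | Op.AM, Op.OI => ENNReal.ofReal q
  | Op.AM, Op.AM => ENNReal.ofReal (1 - q)

/-- One-step transition probabilities of the MMAHH on the state space
`Point n × Op`: the search point moves according to the current acceptance operator, and,
independently, the operator switches according to the two-state Markov chain. -/
noncomputable def mmahhTrans {n : ℕ} (f : Point n → ℝ) (p q : ℝ) :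
    Point n × Op → Point n × Op → ℝ≥0∞ :=
  fun s s' => moveProb f s.2 s.1 s'.1 * switchProb p q s.2 s'.2

/-- `X` is (a version of) the MMAHH Markov chain with objective function `f` and switching
probabilities `p` and `q`, under the measure `μ`: each `X t` is measurable, and conditionally
on any history, the next state is distributed according to `mmahhTrans`. -/
def IsMMAHH {n : ℕ} {Ω : Type*} [MeasurableSpace Ω] (μ : Measure Ω)
    (X : ℕ → Ω → Point n × Op) (f : Point n → ℝ) (p q : ℝ) : Prop :=
  (∀ t, Measurable (X t)) ∧
  ∀ (t : ℕ) (σ : ℕ → Point n × Op) (s' : Point n × Op),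
    μ {ω | (∀ i ≤ t, X i ω = σ i) ∧ X (t + 1) ω = s'}
      = μ {ω | ∀ i ≤ t, X i ω = σ i} * mmahhTrans f p q (σ t) s'

/-- The runtime: the first hitting time of the global optimum, as an extended natural number
(`⊤` if the optimum is never reached). -/
noncomputable def hitTime {n : ℕ} {Ω : Type*} (X : ℕ → Ω → Point n × Op) (ω : Ω) : ℕ∞ :=
  ⨅ t ∈ {t : ℕ | (X t ω).1 = optimum n}, (t : ℕ∞)

/-- The `k`-th switching time between the two acceptance operators (with junk value given by
`Nat.sInf ∅ = 0` on the probability-zero event that no further switch occurs). -/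
noncomputable def switchTime {n : ℕ} {Ω : Type*} (X : ℕ → Ω → Point n × Op) : ℕ → Ω → ℕ
  | 0, _ => 0
  | k + 1, ω =>
      sInf {t : ℕ | switchTime X k ω ≤ t ∧ (X t ω).2 ≠ (X (switchTime X k ω) ω).2}

/-- The Jump benchmark with gap parameter `m`. -/
noncomputable def Jump (n m : ℕ) (x : Point n) : ℝ :=
  if ones x ≤ n - m ∨ ones x = n then (m : ℝ) + (ones x : ℝ) else (n : ℝ) - (ones x : ℝ)

instance : Fintype Op := ⟨{Op.OI, Op.AM}, fun x => by cases x <;> simp⟩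

instance : MeasurableSingletonClass Op := ⟨fun _ => trivial⟩

/-- Markov property on finite histories, integrated form. -/
lemma step_int {S Ω : Type} [Fintype S] [MeasurableSpace S] [MeasurableSingletonClass S]
    [MeasurableSpace Ω] (μ : Measure Ω) (X : ℕ → Ω → S) (P : S → S → ℝ≥0∞)
    (hX : ∀ t, Measurable (X t))
    (hP : ∀ (t : ℕ) (σ : ℕ → S) (s' : S),
      μ {ω | (∀ i ≤ t, X i ω = σ i) ∧ X (t + 1) ω = s'}
        = μ {ω | ∀ i ≤ t, X i ω = σ i} * P (σ t) s')
    (V : S → ℝ≥0∞) (t : ℕ) (g : (Fin (t+1) → S) → ℝ≥0∞) :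
    ∫⁻ ω, g (fun i => X i ω) * V (X (t+1) ω) ∂μ
      = ∫⁻ ω, g (fun i => X i ω) * ∑ s', P (X t ω) s' * V s' ∂μ := by
  classical
  have hH : Measurable (fun ω => (fun i : Fin (t+1) => X i ω)) :=
    measurable_pi_lambda _ fun i => hX i
  have hHX : Measurable (fun ω => ((fun i : Fin (t+1) => X i ω), X (t+1) ω)) :=
    hH.prodMk (hX _)
  have e1 : ∫⁻ ω, g (fun i => X i ω) * V (X (t+1) ω) ∂μ
      = ∑ z : (Fin (t+1) → S) × S, g z.1 * V z.2 *
        μ ((fun ω => ((fun i : Fin (t+1) => X i ω), X (t+1) ω)) ⁻¹' {z}) := by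
    rw [← lintegral_map (f := fun z : (Fin (t+1) → S) × S => g z.1 * V z.2)
      (measurable_of_countable _) hHX, lintegral_fintype]
    refine Finset.sum_congr rfl fun z _ => ?_
    rw [Measure.map_apply hHX (measurableSet_singleton z)]
  have e2 : ∫⁻ ω, g (fun i => X i ω) * ∑ s', P (X t ω) s' * V s' ∂μ
      = ∑ h : (Fin (t+1) → S), (g h * ∑ s', P (h (Fin.last t)) s' * V s') *
        μ ((fun ω => (fun i : Fin (t+1) => X i ω)) ⁻¹' {h}) := by
    have e3 : ∫⁻ ω, g (fun i => X i ω) * ∑ s', P (X t ω) s' * V s' ∂μ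
        = ∫⁻ h, (g h * ∑ s', P (h (Fin.last t)) s' * V s')
          ∂(μ.map (fun ω => (fun i : Fin (t+1) => X i ω))) := by
      rw [lintegral_map (measurable_of_countable _) hH]
      rfl
    rw [e3, lintegral_fintype]
    refine Finset.sum_congr rfl fun h _ => ?_
    rw [Measure.map_apply hH (measurableSet_singleton h)]
  rw [e1, e2, Fintype.sum_prod_type]
  refine Finset.sum_congr rfl fun h _ => ?_
  rw [Finset.mul_sum, Finset.sum_mul]
  refine Finset.sum_congr rfl fun s' _ => ?_
  have key := hP t (fun i => if hi : i < t+1 then h ⟨i, hi⟩ else s') s'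
  have a1 : {ω | (∀ i ≤ t, X i ω = (fun i => if hi : i < t+1 then h ⟨i, hi⟩ else s') i) ∧
      X (t + 1) ω = s'} =
      (fun ω => ((fun i : Fin (t+1) => X i ω), X (t+1) ω)) ⁻¹' {(h, s')} := by
    ext ω
    simp only [Set.mem_ofPred_eq, Set.mem_preimage, Set.mem_singleton_iff, Prod.mk.injEq,
      funext_iff]
    refine and_congr_left fun _ => ⟨fun H i => ?_, fun H i hi => ?_⟩
    · have := H i (by omega)
      simpa [show (i : ℕ) ≤ t by omega] using this
    · have hi' : i < t + 1 := by omega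
      simpa [hi'] using H ⟨i, hi'⟩
  have a2 : {ω | ∀ i ≤ t, X i ω = (fun i => if hi : i < t+1 then h ⟨i, hi⟩ else s') i} =
      (fun ω => (fun i : Fin (t+1) => X i ω)) ⁻¹' {h} := by
    ext ω
    simp only [Set.mem_ofPred_eq, Set.mem_preimage, Set.mem_singleton_iff, funext_iff]
    refine ⟨fun H i => ?_, fun H i hi => ?_⟩
    · have := H i (by omega)
      simpa [show (i : ℕ) ≤ t by omega] using this
    · have hi' : i < t + 1 := by omega
      simpa [hi'] using H ⟨i, hi'⟩
  rw [a1, a2] at key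
  rw [key]
  have : (if hi : t < t+1 then h ⟨t, hi⟩ else s') = h (Fin.last t) := by
    simp [Fin.last]
  rw [this]
  ring

/-- Additive drift theorem for the expected hitting time. -/
lemma drift {S Ω : Type} [Fintype S] [MeasurableSpace S] [MeasurableSingletonClass S]
    [MeasurableSpace Ω] (μ : Measure Ω) (X : ℕ → Ω → S) (P : S → S → ℝ≥0∞)
    (hX : ∀ t, Measurable (X t))
    (hP : ∀ (t : ℕ) (σ : ℕ → S) (s' : S),
      μ {ω | (∀ i ≤ t, X i ω = σ i) ∧ X (t + 1) ω = s'}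
        = μ {ω | ∀ i ≤ t, X i ω = σ i} * P (σ t) s')
    (V : S → ℝ≥0∞) (T : S → Prop)
    (hV : ∀ s, ¬ T s → 1 + ∑ s', P s s' * V s' ≤ V s) :
    ∫⁻ ω, (⨅ t ∈ {t : ℕ | T (X t ω)}, ((t : ℕ∞) : ℝ≥0∞)) ∂μ ≤ ∫⁻ ω, V (X 0 ω) ∂μ := by
  classical
  let g : (t : ℕ) → (Fin (t+1) → S) → ℝ≥0∞ := fun t h => if ∀ i, ¬ T (h i) then 1 else 0
  let G : ℕ → Ω → ℝ≥0∞ := fun t ω => g t (fun i => X i ω)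
  have hGm : ∀ t, Measurable (G t) := fun t =>
    (measurable_of_countable (g t)).comp (measurable_pi_lambda _ fun i => hX i)
  have hVm : ∀ t, Measurable (fun ω => V (X t ω)) := fun t =>
    (measurable_of_countable V).comp (hX t)
  have hG : ∀ t ω, G t ω = if ∀ i ≤ t, ¬ T (X i ω) then 1 else 0 := by
    intro t ω
    simp only [G, g]
    congr 1
    apply propext
    exact ⟨fun H i hi => H ⟨i, by omega⟩, fun H i => H i (by omega)⟩
  have hstep : ∀ t, ∫⁻ ω, G t ω ∂μ + ∫⁻ ω, G (t+1) ω * V (X (t+1) ω) ∂μ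
      ≤ ∫⁻ ω, G t ω * V (X t ω) ∂μ := by
    intro t
    have h1 : ∫⁻ ω, G (t+1) ω * V (X (t+1) ω) ∂μ ≤ ∫⁻ ω, G t ω * V (X (t+1) ω) ∂μ := by
      refine lintegral_mono fun ω => ?_
      refine mul_le_mul_left ?_ _
      rw [hG, hG]
      split_ifs with a b
      · exact le_rfl
      · exact absurd (fun i hi => a i (by omega)) b
      · exact zero_le
      · exact le_rfl
    have h2 := step_int μ X P hX hP V t (g t)
    calc _ ≤ ∫⁻ ω, G t ω ∂μ + ∫⁻ ω, G t ω * ∑ s', P (X t ω) s' * V s' ∂μ := by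
            exact add_le_add_right (h1.trans h2.le) _
      _ = ∫⁻ ω, (G t ω + G t ω * ∑ s', P (X t ω) s' * V s') ∂μ := by
            rw [lintegral_add_left (hGm t)]
      _ ≤ _ := by
            refine lintegral_mono fun ω => ?_
            simp only [hG]
            split_ifs with a
            · simpa using hV _ (a t le_rfl)
            · simp
  have hsum : ∀ N, ∑ t ∈ Finset.range N, ∫⁻ ω, G t ω ∂μ + ∫⁻ ω, G N ω * V (X N ω) ∂μ
      ≤ ∫⁻ ω, V (X 0 ω) ∂μ := by
    intro N
    induction N with
    | zero =>
      simp only [Finset.range_zero, Finset.sum_empty, zero_add]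
      refine lintegral_mono fun ω => ?_
      rw [hG]
      split_ifs <;> simp
    | succ N ih =>
      rw [Finset.sum_range_succ, add_assoc]
      exact (add_le_add_right (hstep N) _).trans ih
  calc _ ≤ ∫⁻ ω, ∑' t, G t ω ∂μ := by
        refine lintegral_mono fun ω => ?_
        by_cases hex : ∃ t, T (X t ω)
        · have hN := Nat.find_spec hex
          refine (iInf₂_le (Nat.find hex) hN).trans ?_
          refine le_trans (le_of_eq ?_) (ENNReal.sum_le_tsum (Finset.range (Nat.find hex)))
          rw [Finset.sum_congr rfl (g := fun _ => (1 : ℝ≥0∞))]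
          · simp
          · intro t ht
            rw [hG, if_pos]
            intro i hi
            exact Nat.find_min hex (lt_of_le_of_lt hi (Finset.mem_range.1 ht))
        · push Not at hex
          have : ∀ t, G t ω = 1 := fun t => by rw [hG, if_pos (fun i _ => hex i)]
          simp [this]
    _ = ∑' t, ∫⁻ ω, G t ω ∂μ := lintegral_tsum fun t => (hGm t).aemeasurable
    _ ≤ _ := by
        refine ENNReal.tsum_le_of_sum_range_le fun N => ?_
        exact le_self_add.trans (hsum N)

/-- Real-valued switching probabilities. -/
noncomputable def swr (p q : ℝ) : Op → Op → ℝ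
  | Op.OI, Op.OI => 1 - p
  | Op.OI, Op.AM => p
  | Op.AM, Op.OI => q
  | Op.AM, Op.AM => 1 - q

lemma sum_op {M : Type*} [AddCommMonoid M] (g : Op → M) : ∑ o, g o = g Op.OI + g Op.AM := by
  rw [show (Finset.univ : Finset Op) = {Op.OI, Op.AM} from rfl]
  rw [Finset.sum_pair (by decide)]

lemma swr_nonneg {p q : ℝ} (hp : 0 < p) (hp1 : p < 1) (hq : 0 < q) (hq1 : q < 1) (o o' : Op) :
    0 ≤ swr p q o o' := by
  cases o <;> cases o' <;> simp only [swr] <;> linarith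

lemma trans_sum {n : ℕ} (hn : 0 < n) (f : Point n → ℝ) {p q : ℝ}
    (hp : 0 < p) (hp1 : p < 1) (hq : 0 < q) (hq1 : q < 1)
    (W : Point n × Op → ℝ) (hW : ∀ s, 0 ≤ W s) (x : Point n) (o : Op) :
    ∑ s', mmahhTrans f p q (x, o) s' * ENNReal.ofReal (W s')
      = ENNReal.ofReal ((∑ v, ∑ o', swr p q o o' * W (movedPoint f o x v, o')) / n) := by
  classical
  have hA : ∀ x', 0 ≤ ∑ o', swr p q o o' * W (x', o') := fun x' =>
    Finset.sum_nonneg fun o' _ => mul_nonneg (swr_nonneg hp hp1 hq hq1 _ _) (hW _)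
  have h1 : ∀ x', ∑ o', switchProb p q o o' * ENNReal.ofReal (W (x', o'))
      = ENNReal.ofReal (∑ o', swr p q o o' * W (x', o')) := by
    intro x'
    rw [ENNReal.ofReal_sum_of_nonneg
      (fun o' _ => mul_nonneg (swr_nonneg hp hp1 hq hq1 _ _) (hW _))]
    refine Finset.sum_congr rfl fun o' _ => ?_
    rw [ENNReal.ofReal_mul (swr_nonneg hp hp1 hq hq1 _ _)]
    cases o <;> cases o' <;> rfl
  rw [ENNReal.ofReal_div_of_pos (by exact_mod_cast hn), ENNReal.ofReal_natCast,
    ENNReal.ofReal_sum_of_nonneg (fun v _ => hA _), Fintype.sum_prod_type]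
  simp only [mmahhTrans, moveProb, mul_assoc, ← Finset.mul_sum, h1]
  simp only [Finset.card_filter, Nat.cast_sum, div_eq_mul_inv, Finset.sum_mul]
  rw [Finset.sum_comm]
  refine Finset.sum_congr rfl fun v _ => ?_
  rw [Finset.sum_eq_single (movedPoint f o x v)]
  · simp [mul_comm]
  · intro b _ hb
    simp [Ne.symm hb]
  · simp

lemma ones_flip_true {n : ℕ} (x : Point n) (v : Fin n) (h : x v = true) :
    ones (flipBit x v) + 1 = ones x := by
  unfold ones
  have : (Finset.univ.filter fun i => flipBit x v i = true)
      = (Finset.univ.filter fun i => x i = true).erase v := by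
    ext i
    by_cases hi : i = v
    · subst hi; simp [flipBit, h]
    · have e : flipBit x v i = x i := by simp [flipBit, hi]
      simp [e, hi]
  rw [this, Finset.card_erase_add_one (by simp [h])]

lemma ones_flip_false {n : ℕ} (x : Point n) (v : Fin n) (h : x v = false) :
    ones (flipBit x v) = ones x + 1 := by
  unfold ones
  have : (Finset.univ.filter fun i => flipBit x v i = true)
      = insert v (Finset.univ.filter fun i => x i = true) := by
    ext i
    by_cases hi : i = v
    · subst hi; simp [flipBit, h]
    · have e : flipBit x v i = x i := by simp [flipBit, hi]
      simp [e, hi]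
  rw [this, Finset.card_insert_of_notMem (by simp [h])]

lemma ones_le {n : ℕ} (x : Point n) : ones x ≤ n := by
  unfold ones
  exact (Finset.card_le_univ _).trans (by simp)

lemma sum_le_ab {n : ℕ} (x : Point n) (F : Fin n → ℝ) (a b : ℝ)
    (ha : ∀ v, x v = true → F v ≤ a) (hb : ∀ v, x v = false → F v ≤ b) :
    ∑ v, F v ≤ ones x * a + (n - ones x) * b := by
  have h1 : ∑ v, F v ≤ ∑ v, if x v = true then a else b := by
    refine Finset.sum_le_sum fun v _ => ?_
    split_ifs with h
    · exact ha v h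
    · exact hb v (by simpa using h)
  refine h1.trans (le_of_eq ?_)
  have h2 : (Finset.univ.filter fun v => ¬ x v = true).card + ones x = n := by
    have := Finset.card_filter_add_card_filter_not (s := (Finset.univ : Finset (Fin n)))
      (fun v => x v = true)
    simp only [Finset.card_univ, Fintype.card_fin] at this
    unfold ones
    omega
  rw [Finset.sum_ite, Finset.sum_const, Finset.sum_const, nsmul_eq_mul, nsmul_eq_mul]
  have h3 : ((Finset.univ.filter fun v => ¬ x v = true).card : ℝ) = n - ones x := by
    rw [eq_sub_iff_add_eq]; exact_mod_cast h2
  rw [h3]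
  rfl

/-- Potential far from the optimum, as a function of the distance. -/
noncomputable def VA (K B r q : ℝ) : Op → ℝ → ℝ
  | Op.OI, y => K * y
  | Op.AM, y => K * (B * y + 1 / r) + 1 / q

lemma drift_AM {n q r K B y : ℝ} (hn : 5 ≤ n) (hq : 0 < q) (hq1 : q < 1)
    (hr : r = q + 2 * (1 - q) / n) (hB : B = q * (1 - 2 / n) / r) :
    1 + ((n - y) * (q * VA K B r q Op.OI (y + 1) + (1 - q) * VA K B r q Op.AM (y + 1))
      + y * (q * VA K B r q Op.OI (y - 1) + (1 - q) * VA K B r q Op.AM (y - 1))) / n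
      ≤ VA K B r q Op.AM y := by
  have hn0 : 0 < n := by linarith
  have hr0 : 0 < r := by
    have : 0 ≤ 2 * (1 - q) / n := div_nonneg (by linarith) hn0.le
    linarith
  have hrn : r * n = q * n + 2 * (1 - q) := by rw [hr]; field_simp
  have hM : (1 - q) * B + q = q / r := by
    rw [hB]; field_simp; linear_combination hrn
  have hBM : B = (q / r) * (1 - 2 / n) := by rw [hB]; ring
  simp only [VA]
  have e : ((n - y) * (q * (K * (y + 1)) + (1 - q) * (K * (B * (y + 1) + 1 / r) + 1 / q))
      + y * (q * (K * (y - 1)) + (1 - q) * (K * (B * (y - 1) + 1 / r) + 1 / q))) / n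
      = K * ((1 - q) * B + q) * (y * (1 - 2 / n) + 1) + (1 - q) * (K * (1 / r) + 1 / q) := by
    field_simp; ring
  rw [e, hM, hBM]
  apply le_of_eq
  field_simp; ring

lemma drift_OI {n m p q r K B y : ℝ} (hn : 5 ≤ n) (hm : 2 ≤ m) (hmn : 2 * m + 1 ≤ n)
    (hp : 0 < p) (hq : 0 < q) (hq1 : q < 1)
    (hc : p ≤ (m / (2 * (n - 2 * m))) * (q + 4 / n))
    (hr : r = q + 2 * (1 - q) / n) (hB : B = q * (1 - 2 / n) / r)
    (hK : K = 2 * (1 + p * n) * (1 / p + 1 / q)) (hy : m + 1 ≤ y) :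
    1 + ((n - y) * ((1 - p) * VA K B r q Op.OI y + p * VA K B r q Op.AM y)
      + y * ((1 - p) * VA K B r q Op.OI (y - 1) + p * VA K B r q Op.AM (y - 1))) / n
      ≤ VA K B r q Op.OI y := by
  have hn0 : 0 < n := by linarith
  have hr0 : 0 < r := by
    have : 0 ≤ 2 * (1 - q) / n := div_nonneg (by linarith) hn0.le
    linarith
  have hrn : r * n = q * n + 2 * (1 - q) := by rw [hr]; field_simp
  have hB1 : 1 - B = 2 / (n * r) := by
    rw [hB]; field_simp; linear_combination hrn
  have hK0 : 0 < K := by rw [hK]; positivity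
  -- condition, cleared of denominators
  have hc' : p * (n - 2 * m) ≤ m * q / 2 + 2 * m / n := by
    have h0 : 0 < n - 2 * m := by linarith
    calc p * (n - 2 * m) ≤ (m / (2 * (n - 2 * m))) * (q + 4 / n) * (n - 2 * m) := by gcongr
      _ = _ := by
        generalize n - 2 * m = w at h0
        field_simp
        ring
  set u := 1 / n with hu
  have hu0 : 0 < u := by positivity
  have hu5 : u ≤ 1 / 5 := by rw [hu]; gcongr
  have hun : u * n = 1 := by rw [hu]; field_simp
  have hru : r = q + 2 * u * (1 - q) := by rw [hr, hu]; ring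
  have hcu : p * (n - 2 * m) ≤ m * q / 2 + 2 * m * u := by
    calc _ ≤ _ := hc'
      _ = _ := by rw [hu]; ring
  have hmu : 2 * m * u + u ≤ 1 := by nlinarith
  have hD : 4 / 5 * (q + u + p) ≤ y * (r + 2 * p * (1 - u)) - p * n := by
    have h1 : (m + 1) * (r + 2 * p * (1 - u)) ≤ y * (r + 2 * p * (1 - u)) := by
      have : 0 ≤ p * (1 - u) := mul_nonneg hp.le (by linarith)
      apply mul_le_mul_of_nonneg_right hy; linarith
    have h2 : 0 ≤ p * (3 / 5 - (m + 1) * u) := mul_nonneg hp.le (by nlinarith)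
    have h3 : 0 ≤ q * (1 / 5 - u) := mul_nonneg hq.le (by linarith)
    have h4 : 0 ≤ m * (q * (1 / 5 - u)) := mul_nonneg (by linarith) h3
    have h5 : 2 * q ≤ m * q := mul_le_mul_of_nonneg_right hm hq.le
    rw [hru] at h1 ⊢
    nlinarith
  have hKD : p * (n * r) ≤ 2 * (1 + p * n) * (y * (r + 2 * p * (1 - u)) - p * n) := by
    have h1 : 2 * (1 + p * n) * (4 / 5 * (q + u + p))
        ≤ 2 * (1 + p * n) * (y * (r + 2 * p * (1 - u)) - p * n) := by
      apply mul_le_mul_of_nonneg_left hD; positivity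
    refine le_trans ?_ h1
    have h2 : p * n * u = p := by rw [mul_assoc, mul_comm n, hun, mul_one]
    have h3 : 0 < p * n * p := by positivity
    have h4 : 0 < p * n * q := by positivity
    have h5 : 0 < p * q := by positivity
    nlinarith
  have hfin : 1 + p / q ≤ K * (y * (u + (1 - u) * (2 * p * (1 / (n * r)))) - p / r) := by
    have e1 : y * (u + (1 - u) * (2 * p * (1 / (n * r)))) - p / r
        = (y * (r + 2 * p * (1 - u)) - p * n) / (n * r) := by
      rw [hu]; field_simp
    have e2 : 1 + p / q = p * (1 / p + 1 / q) := by field_simp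
    rw [e1, e2, hK, ← mul_div_assoc, le_div_iff₀ (by positivity)]
    have h1 : 0 < 1 / p + 1 / q := by positivity
    nlinarith [mul_le_mul_of_nonneg_right hKD h1.le]
  simp only [VA]
  have e : ((n - y) * ((1 - p) * (K * y) + p * (K * (B * y + 1 / r) + 1 / q))
      + y * ((1 - p) * (K * (y - 1)) + p * (K * (B * (y - 1) + 1 / r) + 1 / q))) / n
      = K * y * (1 - u) * (1 - p * (1 - B)) + p * (K * (1 / r) + 1 / q) := by
    rw [hu]; field_simp; ring
  rw [e, hB1]
  have e3 : K * (y * (u + (1 - u) * (2 * p * (1 / (n * r)))) - p / r)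
      = K * y - K * y * (1 - u) * (1 - p * (2 / (n * r))) - p * (K * (1 / r)) := by ring
  have e4 : p * (1 / q) = p / q := by ring
  linarith

/-- The full potential. -/
noncomputable def W (n m : ℕ) (K B r q : ℝ) (s : Point n × Op) : ℝ :=
  if ones s.1 < n - m then VA K B r q s.2 ((n : ℝ) - ones s.1)
  else ((ones s.1 : ℝ) - (n - m)) * n / 3

/-- Average time to climb towards a (local or global) maximum of `Jump_m`
(Lemma 11 of the paper). -/
theorem avg_time_to_climb :
    ∃ C : ℝ, 0 < C ∧
      ∀ (n m : ℕ) (p q : ℝ), 3 ≤ n → 1 < m → 2 * m < n →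
        0 < p → p < 1 → 0 < q → q < 1 →
        p ≤ ((m : ℝ) / (2 * ((n : ℝ) - 2 * (m : ℝ)))) * (q + 4 / (n : ℝ)) →
        ∀ (Ω : Type) [MeasurableSpace Ω] (μ : Measure Ω) (X : ℕ → Ω → Point n × Op),
          IsProbabilityMeasure μ →
          IsMMAHH μ X (Jump n m) p q →
          ∀ x0 : Point n, μ {ω | X 0 ω = (x0, Op.OI)} = 1 →
            ∫⁻ ω, ((⨅ t ∈ {t : ℕ | ones (X t ω).1 = n - m ∨ ones (X t ω).1 = n},
                (t : ℕ∞)) : ℝ≥0∞) ∂μ ≤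
              ENNReal.ofReal (C * (n : ℝ) * (1 + p * (n : ℝ)) * (1 / p + 1 / q)) := by
  refine ⟨2, by norm_num, ?_⟩
  intro n m p q hn hm hmn hp hp1 hq hq1 hc Ω _ μ X hμ hX x0 h0
  obtain ⟨r, hr⟩ : ∃ r : ℝ, r = q + 2 * (1 - q) / n := ⟨_, rfl⟩
  obtain ⟨B, hB⟩ : ∃ B : ℝ, B = q * (1 - 2 / n) / r := ⟨_, rfl⟩
  obtain ⟨K, hK⟩ : ∃ K : ℝ, K = 2 * (1 + p * n) * (1 / p + 1 / q) := ⟨_, rfl⟩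
  have hn5 : (5 : ℝ) ≤ n := by exact_mod_cast (by omega : 5 ≤ n)
  have hm2 : (2 : ℝ) ≤ m := by exact_mod_cast (by omega : 2 ≤ m)
  have hmn' : 2 * (m : ℝ) + 1 ≤ n := by exact_mod_cast (by omega : 2 * m + 1 ≤ n)
  have hn0 : (0 : ℝ) < n := by linarith
  have hr0 : 0 < r := by
    have : 0 ≤ 2 * (1 - q) / (n : ℝ) := div_nonneg (by linarith) hn0.le
    linarith
  have hB0 : 0 ≤ B := by
    rw [hB]
    have : 2 / (n : ℝ) ≤ 1 := by rw [div_le_one hn0]; linarith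
    exact div_nonneg (mul_nonneg hq.le (by linarith)) hr0.le
  have hK0 : 0 < K := by rw [hK]; positivity
  have hVA0 : ∀ o y, 0 ≤ y → 0 ≤ VA K B r q o y := by
    intro o y hy
    cases o <;> simp only [VA] <;> positivity
  have hsub : ((n - m : ℕ) : ℝ) = (n : ℝ) - m := by
    rw [Nat.cast_sub (by omega)]
  have hW0 : ∀ s, 0 ≤ W n m K B r q s := by
    intro s
    unfold W
    have := ones_le s.1
    split_ifs with h
    · apply hVA0
      have : (ones s.1 : ℝ) ≤ n := by exact_mod_cast this
      linarith
    · have h' : ((n - m : ℕ) : ℝ) ≤ ones s.1 := by exact_mod_cast not_lt.1 h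
      rw [hsub] at h'
      have : 0 ≤ (ones s.1 : ℝ) - (n - m) := by linarith
      positivity
  have hd := drift μ X (mmahhTrans (Jump n m) p q) hX.1 hX.2
    (fun s => ENNReal.ofReal (W n m K B r q s))
    (fun s => ones s.1 = n - m ∨ ones s.1 = n) (by
      rintro ⟨x, o⟩ hs
      push Not at hs
      obtain ⟨hs1, hs2⟩ := hs
      simp only at hs1 hs2
      rw [trans_sum (by omega) _ hp hp1 hq hq1 _ hW0]
      rw [← ENNReal.ofReal_one, ← ENNReal.ofReal_add zero_le_one (div_nonneg
        (Finset.sum_nonneg fun v _ => Finset.sum_nonneg fun o' _ =>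
          mul_nonneg (swr_nonneg hp hp1 hq hq1 _ _) (hW0 _)) hn0.le)]
      apply ENNReal.ofReal_le_ofReal
      have hle := ones_le x
      by_cases hk : ones x < n - m
      · -- region above the local maximum layer
        have hWx : W n m K B r q (x, o) = VA K B r q o ((n : ℝ) - ones x) := by
          unfold W; rw [if_pos hk]
        have hy : (m : ℝ) + 1 ≤ (n : ℝ) - ones x := by
          have : ones x + 1 + m ≤ n := by omega
          have : (ones x : ℝ) + 1 + m ≤ n := by exact_mod_cast this
          linarith
        have hWle : ∀ (x' : Point n) (o' : Op), ones x' ≤ n - m →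
            W n m K B r q (x', o') ≤ VA K B r q o' ((n : ℝ) - ones x') := by
          intro x' o' h
          unfold W
          split_ifs with h'
          · exact le_rfl
          · simp only at h'
            have he : ones x' = n - m := by omega
            have : (ones x' : ℝ) = n - m := by rw [he, hsub]
            simp only [this, sub_self, zero_mul, zero_div]
            apply hVA0; linarith
        rw [hWx]
        cases o with
        | OI =>
          refine le_trans ?_ (drift_OI hn5 hm2 hmn' hp hq hq1 hc hr hB hK hy)
          rw [sub_sub_cancel]
          gcongr
          refine sum_le_ab x _ _ _ ?_ ?_
          · intro v hv
            have h1 := ones_flip_true x v hv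
            have h1' : (ones (flipBit x v) : ℝ) + 1 = ones x := by exact_mod_cast h1
            have : movedPoint (Jump n m) Op.OI x v = x := by
              simp only [movedPoint]
              rw [if_neg]
              simp only [Jump]
              rw [if_pos (Or.inl hk.le), if_pos (Or.inl (by omega))]
              linarith
            rw [this, sum_op]
            simp only [swr]
            have a1 := hWle x Op.OI hk.le
            have a2 := hWle x Op.AM hk.le
            have : 0 ≤ 1 - p := by linarith
            gcongr
          · intro v hv
            have h1 := ones_flip_false x v hv
            have h1' : (ones (flipBit x v) : ℝ) = ones x + 1 := by exact_mod_cast h1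
            have : movedPoint (Jump n m) Op.OI x v = flipBit x v := by
              simp only [movedPoint]
              rw [if_pos]
              simp only [Jump]
              rw [if_pos (Or.inl hk.le), if_pos (Or.inl (by omega))]
              linarith
            rw [this, sum_op]
            simp only [swr]
            have a1 := hWle (flipBit x v) Op.OI (by omega)
            have a2 := hWle (flipBit x v) Op.AM (by omega)
            rw [h1', ← sub_sub] at a1 a2
            have : 0 ≤ 1 - p := by linarith
            gcongr
        | AM =>
          refine le_trans ?_ (drift_AM hn5 hq hq1 hr hB)
          rw [sub_sub_cancel]
          gcongr
          refine sum_le_ab x _ _ _ ?_ ?_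
          · intro v hv
            have h1 := ones_flip_true x v hv
            have h1' : (ones (flipBit x v) : ℝ) + 1 = ones x := by exact_mod_cast h1
            simp only [movedPoint]
            rw [sum_op]
            simp only [swr]
            have a1 := hWle (flipBit x v) Op.OI (by omega)
            have a2 := hWle (flipBit x v) Op.AM (by omega)
            have e : (n : ℝ) - ones (flipBit x v) = n - ones x + 1 := by linarith
            rw [e] at a1 a2
            have : 0 ≤ 1 - q := by linarith
            gcongr
          · intro v hv
            have h1 := ones_flip_false x v hv
            have h1' : (ones (flipBit x v) : ℝ) = ones x + 1 := by exact_mod_cast h1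
            simp only [movedPoint]
            rw [sum_op]
            simp only [swr]
            have a1 := hWle (flipBit x v) Op.OI (by omega)
            have a2 := hWle (flipBit x v) Op.AM (by omega)
            rw [h1', ← sub_sub] at a1 a2
            have : 0 ≤ 1 - q := by linarith
            gcongr
      · -- region between the local maxima and the optimum
        have hWge : ∀ (x' : Point n) (o' : Op), n - m ≤ ones x' →
            W n m K B r q (x', o') = ((ones x' : ℝ) - (n - m)) * n / 3 := by
          intro x' o' h
          unfold W
          rw [if_neg (not_lt.2 h)]
        have hsw : ∀ z : ℝ, ∑ o', swr p q o o' * z = z := by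
          intro z
          rw [sum_op]
          cases o <;> simp only [swr] <;> ring
        have hkR : (n : ℝ) - m + 1 ≤ ones x := by
          have : n + 1 ≤ ones x + m := by omega
          have : (n : ℝ) + 1 ≤ ones x + m := by exact_mod_cast this
          linarith
        have hmain : ∑ v, ∑ o', swr p q o o' * W n m K B r q (movedPoint (Jump n m) o x v, o')
            ≤ ones x * (((ones x : ℝ) - 1 - (n - m)) * n / 3)
              + (n - ones x) * (((ones x : ℝ) + 1 - (n - m)) * n / 3) := by
          refine sum_le_ab x _ _ _ ?_ ?_
          · intro v hv
            have h1 := ones_flip_true x v hv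
            have h1' : (ones (flipBit x v) : ℝ) + 1 = ones x := by exact_mod_cast h1
            have hmv : movedPoint (Jump n m) o x v = flipBit x v := by
              cases o with
              | AM => rfl
              | OI =>
                simp only [movedPoint]
                rw [if_pos]
                simp only [Jump]
                rw [if_neg (by omega)]
                split_ifs
                · linarith
                · linarith
            simp only [hmv, hWge (flipBit x v) _ (by omega), hsw]
            apply le_of_eq; rw [← h1']; ring
          · intro v hv
            have h1 := ones_flip_false x v hv
            have h1' : (ones (flipBit x v) : ℝ) = ones x + 1 := by exact_mod_cast h1
            have hmv : movedPoint (Jump n m) o x v = flipBit x v ∨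
                movedPoint (Jump n m) o x v = x := by
              cases o with
              | AM => exact Or.inl rfl
              | OI =>
                simp only [movedPoint]
                split_ifs
                · exact Or.inl rfl
                · exact Or.inr rfl
            rcases hmv with hmv | hmv
            · simp only [hmv, hWge (flipBit x v) _ (by omega), hsw]
              rw [h1']
            · simp only [hmv, hWge x _ (by omega), hsw]
              gcongr
              linarith
        rw [hWge x o (by omega)]
        have : (∑ v, ∑ o', swr p q o o' * W n m K B r q (movedPoint (Jump n m) o x v, o')) / n
            ≤ (ones x * (((ones x : ℝ) - 1 - (n - m)) * n / 3)
              + (n - ones x) * (((ones x : ℝ) + 1 - (n - m)) * n / 3)) / n := by gcongr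
        have e : (ones x * (((ones x : ℝ) - 1 - (n - m)) * n / 3)
              + (n - ones x) * (((ones x : ℝ) + 1 - (n - m)) * n / 3)) / n
            = ((ones x : ℝ) - (n - m)) * n / 3 - (2 * ones x - n) / 3 := by
          field_simp; ring
        have : 3 ≤ 2 * (ones x : ℝ) - n := by linarith
        linarith)
  refine hd.trans ?_
  have hae : ∀ᵐ ω ∂μ, X 0 ω = (x0, Op.OI) := by
    have hms : MeasurableSet {ω | X 0 ω = (x0, Op.OI)} :=
      (hX.1 0) (measurableSet_singleton _)
    exact (prob_compl_eq_zero_iff hms).2 h0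
  rw [lintegral_congr_ae (g := fun _ => ENNReal.ofReal (W n m K B r q (x0, Op.OI)))
    (hae.mono fun ω h => by simp only [h])]
  simp only [lintegral_const, measure_univ, mul_one]
  apply ENNReal.ofReal_le_ofReal
  have hle := ones_le x0
  have hle' : (ones x0 : ℝ) ≤ n := by exact_mod_cast hle
  have e : 2 * (n : ℝ) * (1 + p * n) * (1 / p + 1 / q) = K * n := by rw [hK]; ring
  rw [e]
  unfold W
  split_ifs with h
  · simp only [VA]
    gcongr
    simp
  · have hKn : 2 * (n : ℝ) ≤ K := by
      have : K = 2 * n + (2 * (1 / p) + 2 * (1 + p * n) * (1 / q)) := by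
        rw [hK]; field_simp; ring
      rw [this]
      have : 0 < 2 * (1 / p) + 2 * (1 + p * n) * (1 / q) := by positivity
      linarith
    simp only
    have h1 : ((ones x0 : ℝ) - (n - m)) / 3 ≤ K := by linarith
    calc _ = ((ones x0 : ℝ) - (n - m)) / 3 * n := by ring
      _ ≤ _ := by gcongr
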